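/- Let G = (V, Σ, P) be a context-free grammar, k ∈ ℕ, and let G^{≤k} be its unfolding. For every X ∈ V and every w ∈ Σ*, the ambiguity satisfies amb_{G^{≤k}, X^{≤k}}(w) = |{t : t is a (G,X)-derivation tree, Y(t) = w and dim(t) ≤ k}|. -/

import Mathlib

/-- A context-free grammar over variables `V` and terminal alphabet `A`:
a set of productions `X → rhs` with `rhs ∈ (A ⊕ V)*`. -/
structure CFG (V : Type) (A : Type) where
  P : Set (V × List (A ⊕ V))

/-- The list of variable occurrences (in order) in a sentential form. -/
def varsOf {V A : Type} (rhs : List (A ⊕ V)) : List V :=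
  rhs.filterMap Sum.getRight?

/-- Raw derivation trees: each node is labeled by a variable and a right-hand side,
and carries the list of subtrees (one per variable occurrence of the rhs). -/
inductive RawTree (V A : Type) : Type where
  | node (X : V) (rhs : List (A ⊕ V)) (children : List (RawTree V A)) : RawTree V A

namespace RawTree

/-- `IsDTree G X t` : `t` is a `(G,X)`-derivation tree. -/
inductive IsDTree {V A : Type} (G : CFG V A) : V → RawTree V A → Prop where
  | node {X : V} {rhs : List (A ⊕ V)} {children : List (RawTree V A)}
      (hP : (X, rhs) ∈ G.P)
      (hch : List.Forall₂ (IsDTree G) (varsOf rhs) children) :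
      IsDTree G X (RawTree.node X rhs children)

/-- Helper for `yield`: interleave the terminals of a rhs with the yields of the
subtrees (consumed in order, one per variable occurrence). -/
def yieldAux {V A : Type} : List (A ⊕ V) → List (List A) → List A
  | [], _ => []
  | (Sum.inl a) :: rest, ys => a :: yieldAux rest ys
  | (Sum.inr _) :: rest, [] => yieldAux rest []
  | (Sum.inr _) :: rest, y :: ys => y ++ yieldAux rest ys

/-- The yield of a derivation tree. -/
def yield {V A : Type} : RawTree V A → List A
  | .node _ rhs cs => yieldAux rhs (cs.attach.map (fun c => yield c.1))
decreasing_by have := List.sizeOf_lt_of_mem c.2; simp; omega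

/-- The dimension (Horton–Strahler number) of a tree. -/
def dim {V A : Type} : RawTree V A → ℕ
  | .node _ _ cs =>
    let ds := cs.attach.map (fun c => dim c.1)
    if ds.isEmpty then 0
    else
      let d := ds.foldr max 0
      if ds.count d = 1 then d else d + 1
decreasing_by have := List.sizeOf_lt_of_mem c.2; simp; omega

/-- The set of variables occurring as left-hand side of a label of some node of `t`. -/
def lhsVars {V A : Type} [DecidableEq V] : RawTree V A → Finset V
  | .node X _ cs => insert X ((cs.attach.map (fun c => lhsVars c.1)).foldr (· ∪ ·) ∅)
decreasing_by have := List.sizeOf_lt_of_mem c.2; simp; omega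

/-- `l(t)`: the number of distinct variables labelling (as lhs) the nodes of `t`. -/
def numLhsVars {V A : Type} [DecidableEq V] (t : RawTree V A) : ℕ := (lhsVars t).card

end RawTree

open RawTree

/-- The Parikh image of a word. -/
noncomputable def parikh {A : Type} (w : List A) : A →₀ ℕ :=
  (w.map (fun a => Finsupp.single a 1)).sum

/-- The ambiguity of `(G,X)` at a word `w`: the number of `(G,X)`-derivation trees
with yield `w`, as an extended natural number. -/
noncomputable def amb {V A : Type} (G : CFG V A) (X : V) (w : List A) : ℕ∞ :=
  Set.encard {t : RawTree V A | IsDTree G X t ∧ yield t = w}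

/-- The commutative ambiguity of `(G,X)` at a Parikh vector `v`: the number of
`(G,X)`-derivation trees whose yield has Parikh image `v`. -/
noncomputable def camb {V A : Type} (G : CFG V A) (X : V) (v : A →₀ ℕ) : ℕ∞ :=
  Set.encard {t : RawTree V A | IsDTree G X t ∧ parikh (yield t) = v}

/-- One rewriting step of `G` on sentential forms. -/
def Produces {V A : Type} (G : CFG V A) (α β : List (A ⊕ V)) : Prop :=
  ∃ pre post X rhs, (X, rhs) ∈ G.P ∧
    α = pre ++ Sum.inr X :: post ∧ β = pre ++ rhs ++ post

/-- Derivation in one or more steps (`⇒⁺`). -/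
def DerivesPlus {V A : Type} (G : CFG V A) : List (A ⊕ V) → List (A ⊕ V) → Prop :=
  Relation.TransGen (Produces G)

/-- Derivation in zero or more steps (`⇒*`). -/
def Derives {V A : Type} (G : CFG V A) : List (A ⊕ V) → List (A ⊕ V) → Prop :=
  Relation.ReflTransGen (Produces G)

/-- A grammar is nonexpansive if no variable `X` derives a sentential form
containing two or more occurrences of `X`. -/
def Nonexpansive {V A : Type} [DecidableEq V] [DecidableEq A] (G : CFG V A) : Prop :=
  ∀ (X : V) (α : List (A ⊕ V)), DerivesPlus G [Sum.inr X] α → α.count (Sum.inr X) ≤ 1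

/-! ### The unfolded grammar `G^{≤k}` -/

/-- Variables of the unfolded grammar: `UVar.le X d` stands for `X^{≤d}` and
`UVar.eq X d` stands for `X^{=d}`. -/
inductive UVar (V : Type) : Type where
  | le (X : V) (d : ℕ) : UVar V
  | eq (X : V) (d : ℕ) : UVar V
  deriving DecidableEq

/-- Replace, in order, each variable occurrence of `rhs` by the corresponding
annotated variable from `zs` (terminals are kept). -/
def relabel {V A : Type} : List (A ⊕ V) → List (UVar V) → List (A ⊕ UVar V)
  | [], _ => []
  | (Sum.inl a) :: rest, zs => Sum.inl a :: relabel rest zs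
  | (Sum.inr _) :: rest, [] => relabel rest []
  | (Sum.inr _) :: rest, z :: zs => Sum.inr z :: relabel rest zs

/-- The productions of the unfolded grammar `G^{≤k}`. -/
def unfoldP {V A : Type} (G : CFG V A) (k : ℕ) : Set (UVar V × List (A ⊕ UVar V)) :=
  -- (1)  X^{≤d} → X^{=e}  for e ≤ d ≤ k
  { p | ∃ X d e, e ≤ d ∧ d ≤ k ∧ p = (UVar.le X d, [Sum.inr (UVar.eq X e)]) } ∪
  -- (2)  X^{=0} → u₀  whenever X → u₀ with u₀ ∈ Σ*
  { p | ∃ X rhs, (X, rhs) ∈ G.P ∧ varsOf rhs = [] ∧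
        p = (UVar.eq X 0, relabel rhs []) } ∪
  -- (3)  X^{=d} → u₀ X₁^{=d} u₁  whenever X → u₀X₁u₁ (one variable occurrence), d ≤ k
  { p | ∃ X rhs Y d, (X, rhs) ∈ G.P ∧ varsOf rhs = [Y] ∧ d ≤ k ∧
        p = (UVar.eq X d, relabel rhs [UVar.eq Y d]) } ∪
  -- (4a)
  { p | ∃ X rhs d j, (X, rhs) ∈ G.P ∧ 2 ≤ (varsOf rhs).length ∧
        1 ≤ d ∧ d ≤ k ∧ j < (varsOf rhs).length ∧
        p = (UVar.eq X d, relabel rhs ((varsOf rhs).mapIdx (fun i Y =>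
              if i = j then UVar.eq Y d else UVar.le Y (d - 1)))) } ∪
  -- (4b)
  { p | ∃ X rhs d, ∃ J : Finset ℕ, (X, rhs) ∈ G.P ∧ 2 ≤ (varsOf rhs).length ∧
        1 ≤ d ∧ d ≤ k ∧ 2 ≤ J.card ∧ (∀ i ∈ J, i < (varsOf rhs).length) ∧
        (2 ≤ d ∨ J = Finset.range (varsOf rhs).length) ∧
        p = (UVar.eq X d, relabel rhs ((varsOf rhs).mapIdx (fun i Y =>
              if i ∈ J then UVar.eq Y (d - 1) else UVar.le Y (d - 2)))) }

/-- The unfolded grammar `G^{≤k}`. -/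
def unfold {V A : Type} (G : CFG V A) (k : ℕ) : CFG (UVar V) A :=
  ⟨unfoldP G k⟩

namespace UVar

/-- The variable of `G` underlying a variable of the unfolded grammar. -/
def var {V : Type} : UVar V → V
  | le X _ => X
  | eq X _ => X

/-- The dimension bound carried by a variable of the unfolded grammar. -/
def level {V : Type} : UVar V → ℕ
  | le _ d => d
  | eq _ d => d

/-- The constraint that a variable of the unfolded grammar puts on the dimension of a tree. -/
def Admits {V : Type} : UVar V → ℕ → Prop
  | le _ d, n => n ≤ d
  | eq _ d, n => n = d

end UVar

/-! ### Right-hand sides -/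

section Rhs

variable {V A : Type}

@[simp]
theorem varsOf_inl_cons (a : A) (rest : List (A ⊕ V)) :
    varsOf (Sum.inl a :: rest) = varsOf rest :=
  rfl

@[simp]
theorem varsOf_inr_cons (Y : V) (rest : List (A ⊕ V)) :
    varsOf (Sum.inr Y :: rest) = Y :: varsOf rest :=
  rfl

theorem varsOf_relabel (rhs : List (A ⊕ V)) (zs : List (UVar V))
    (h : zs.length = (varsOf rhs).length) : varsOf (relabel rhs zs) = zs := by
  induction rhs generalizing zs with
  | nil => simpa [varsOf, relabel, eq_comm] using h
  | cons s rest ih =>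
    cases s with
    | inl a => simpa [relabel] using ih zs (by simpa using h)
    | inr Y =>
      cases zs with
      | nil => simp at h
      | cons z zs => simpa [relabel] using ih zs (by simpa using h)

theorem map_var_relabel (rhs : List (A ⊕ V)) (zs : List (UVar V))
    (h : zs.map UVar.var = varsOf rhs) :
    (relabel rhs zs).map (Sum.map id UVar.var) = rhs := by
  induction rhs generalizing zs with
  | nil => rfl
  | cons s rest ih =>
    cases s with
    | inl a => simpa [relabel] using ih zs (by simpa using h)
    | inr Y =>
      cases zs with
      | nil => simp at h
      | cons z zs =>
        have h' : z.var = Y ∧ zs.map UVar.var = varsOf rest := by simpa using h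
        simp [relabel, ih zs h'.2, h'.1]

theorem yieldAux_relabel (rhs : List (A ⊕ V)) (zs : List (UVar V)) (ys : List (List A))
    (h : zs.length = (varsOf rhs).length) :
    yieldAux (relabel rhs zs) ys = yieldAux rhs ys := by
  induction rhs generalizing zs ys with
  | nil => rfl
  | cons s rest ih =>
    cases s with
    | inl a => simpa [relabel, yieldAux] using ih zs ys (by simpa using h)
    | inr Y =>
      cases zs with
      | nil => simp at h
      | cons z zs =>
        have h' : zs.length = (varsOf rest).length := by simpa using h
        cases ys <;> simp [relabel, yieldAux, ih zs _ h']

end Rhs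

/-! ### Dimension of a node in terms of the dimensions of its children -/

/-- The dimension of a tree whose children have dimensions `ds`. -/
def hortonStrahler (ds : List ℕ) : ℕ :=
  if ds.isEmpty then 0
  else if ds.count (ds.foldr max 0) = 1 then ds.foldr max 0 else ds.foldr max 0 + 1

theorem List.foldr_max_eq_of_mem {ds : List ℕ} {m : ℕ} (hm : m ∈ ds) (hle : ∀ n ∈ ds, n ≤ m) :
    ds.foldr max 0 = m := by
  refine le_antisymm ?_ (List.le_max_of_le' 0 hm le_rfl)
  clear hm
  induction ds with
  | nil => simp
  | cons a ds ih => simp_all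

theorem List.foldr_max_mem {ds : List ℕ} (h : ds ≠ []) : ds.foldr max 0 ∈ ds := by
  induction ds with
  | nil => contradiction
  | cons a ds ih =>
    by_cases hds : ds = []
    · simp [hds]
    · rcases max_choice a (ds.foldr max 0) with hm | hm
      · simp [hm]
      · simp [hm, ih hds]

theorem List.le_foldr_max {ds : List ℕ} {n : ℕ} (h : n ∈ ds) : n ≤ ds.foldr max 0 :=
  List.le_max_of_le' 0 h le_rfl

theorem List.two_le_count_iff {ds : List ℕ} {m : ℕ} :
    2 ≤ ds.count m ↔ ∃ i j : ℕ, i < j ∧ ds[i]? = some m ∧ ds[j]? = some m := by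
  rw [← List.duplicate_iff_two_le_count, List.duplicate_iff_exists_distinct_get]
  constructor
  · rintro ⟨i, j, hij, hi, hj⟩
    exact ⟨i, j, hij, by simp [hi], by simp [hj]⟩
  · rintro ⟨i, j, hij, hi, hj⟩
    obtain ⟨hi', hi⟩ := List.getElem?_eq_some_iff.1 hi
    obtain ⟨hj', hj⟩ := List.getElem?_eq_some_iff.1 hj
    exact ⟨⟨i, hi'⟩, ⟨j, hj'⟩, hij, by simp [hi], by simp [hj]⟩

theorem hortonStrahler_of_unique {ds : List ℕ} {j m : ℕ} (hj : ds[j]? = some m)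
    (h : ∀ i n, i ≠ j → ds[i]? = some n → n < m) :
    ds.foldr max 0 = m ∧ hortonStrahler ds = m := by
  have hmem : m ∈ ds := List.mem_of_getElem? hj
  have hmax : ds.foldr max 0 = m := by
    refine List.foldr_max_eq_of_mem hmem fun n hn => ?_
    obtain ⟨i, hi⟩ := List.mem_iff_getElem?.1 hn
    by_cases hij : i = j
    · subst hij; simp_all
    · exact (h i n hij hi).le
  have hpos : 0 < ds.count m := List.count_pos_iff.2 hmem
  have hlt : ¬ 2 ≤ ds.count m := by
    rw [List.two_le_count_iff]
    rintro ⟨a, b, hab, ha, hb⟩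
    by_cases haj : a = j
    · exact (h b m (by omega) hb).false
    · exact (h a m haj ha).false
  refine ⟨hmax, ?_⟩
  have hne : ds ≠ [] := List.ne_nil_of_mem hmem
  have hc : ds.count m = 1 := by omega
  simp [hortonStrahler, hmax, hne, hc]

theorem hortonStrahler_of_two_le_count {ds : List ℕ} {m : ℕ} (hc : 2 ≤ ds.count m)
    (h : ∀ n ∈ ds, n ≤ m) : ds.foldr max 0 = m ∧ hortonStrahler ds = m + 1 := by
  have hmem : m ∈ ds := List.count_pos_iff.1 (by omega)
  have hmax := List.foldr_max_eq_of_mem hmem h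
  have hne : ds ≠ [] := List.ne_nil_of_mem hmem
  have hc' : ds.count m ≠ 1 := by omega
  exact ⟨hmax, by simp [hortonStrahler, hmax, hne, hc']⟩

namespace RawTree

variable {V A : Type}

theorem yield_node (X : V) (rhs : List (A ⊕ V)) (cs : List (RawTree V A)) :
    yield (node X rhs cs) = yieldAux rhs (cs.map yield) := by
  rw [yield, List.attach_map_val (f := yield)]

theorem dim_node (X : V) (rhs : List (A ⊕ V)) (cs : List (RawTree V A)) :
    dim (node X rhs cs) = hortonStrahler (cs.map dim) := by
  rw [dim, List.attach_map_val (f := dim)]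
  rfl

theorem node_induction {motive : RawTree V A → Prop}
    (h : ∀ X rhs cs, (∀ c ∈ cs, motive c) → motive (node X rhs cs)) : ∀ t, motive t
  | node X rhs cs => h X rhs cs fun c _ => node_induction h c

theorem isDTree_node_iff {G : CFG V A} {X Y : V} {rhs : List (A ⊕ V)}
    {cs : List (RawTree V A)} :
    IsDTree G X (node Y rhs cs) ↔
      Y = X ∧ (X, rhs) ∈ G.P ∧ List.Forall₂ (IsDTree G) (varsOf rhs) cs := by
  constructor
  · rintro ⟨hP, hch⟩
    exact ⟨rfl, hP, hch⟩
  · rintro ⟨rfl, hP, hch⟩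
    exact .node hP hch

/-- Forget the dimension annotations of a tree of the unfolded grammar, contracting the nodes
labelled by the productions `X^{≤d} → X^{=e}`. -/
def erase : RawTree (UVar V) A → RawTree V A
  | node (UVar.le _ _) _ [c] => erase c
  | node (UVar.le X _) _ _ => node X [] []
  | node (UVar.eq X _) rhs cs =>
      node X (rhs.map (Sum.map id UVar.var)) (cs.attach.map fun c => erase c.1)
decreasing_by
  · simp; omega
  · have := List.sizeOf_lt_of_mem c.2; simp; omega

theorem erase_le (X : V) (d : ℕ) (rhs : List (A ⊕ UVar V)) (c : RawTree (UVar V) A) :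
    erase (node (UVar.le X d) rhs [c]) = erase c := by
  rw [erase]

theorem erase_eq (X : V) (d : ℕ) (rhs : List (A ⊕ UVar V)) (cs : List (RawTree (UVar V) A)) :
    erase (node (UVar.eq X d) rhs cs) =
      node X (rhs.map (Sum.map id UVar.var)) (cs.map erase) := by
  rw [erase, List.attach_map_val (f := erase)]

end RawTree

/-! ### Annotations of the variables of a right-hand side -/

/-- `IsAnnotation d Xs zs`: the unfolded grammar has productions of `X^{=d}` that
annotate the variable occurrences `Xs` of a right-hand side by `zs`. -/
inductive IsAnnotation {V : Type} (d : ℕ) : List V → List (UVar V) → Prop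
  | nil (hd : d = 0) : IsAnnotation d [] []
  | singleton (Y : V) : IsAnnotation d [Y] [UVar.eq Y d]
  | unique (Xs : List V) (j : ℕ) (hXs : 2 ≤ Xs.length) (hd : 1 ≤ d) (hj : j < Xs.length) :
      IsAnnotation d Xs (Xs.mapIdx fun i Y => if i = j then UVar.eq Y d else UVar.le Y (d - 1))
  | multiple (Xs : List V) (J : Finset ℕ) (hXs : 2 ≤ Xs.length) (hd : 1 ≤ d) (hJ : 2 ≤ J.card)
      (hJlt : ∀ i ∈ J, i < Xs.length) (hdJ : 2 ≤ d ∨ J = Finset.range Xs.length) :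
      IsAnnotation d Xs
        (Xs.mapIdx fun i Y => if i ∈ J then UVar.eq Y (d - 1) else UVar.le Y (d - 2))

/-- The annotation of the variable occurrences `Xs` that fits subtrees of dimensions `ds`. -/
def annotate {V : Type} (Xs : List V) (ds : List ℕ) : List (UVar V) :=
  List.zipWith (fun Y n => if n = ds.foldr max 0 then UVar.eq Y (ds.foldr max 0)
    else UVar.le Y (ds.foldr max 0 - 1)) Xs ds

section Annotation

variable {V A : Type}

theorem IsAnnotation.map_var {d : ℕ} {Xs : List V} {zs : List (UVar V)}
    (h : IsAnnotation d Xs zs) : zs.map UVar.var = Xs := by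
  cases h with
  | nil => rfl
  | singleton => rfl
  | unique =>
    refine List.ext_getElem (by simp) fun i _ _ => ?_
    simp only [List.getElem_map, List.getElem_mapIdx]
    split_ifs <;> rfl
  | multiple =>
    refine List.ext_getElem (by simp) fun i _ _ => ?_
    simp only [List.getElem_map, List.getElem_mapIdx]
    split_ifs <;> rfl

theorem IsAnnotation.length_eq {d : ℕ} {Xs : List V} {zs : List (UVar V)}
    (h : IsAnnotation d Xs zs) : zs.length = Xs.length := by
  rw [← h.map_var, List.length_map]

theorem IsAnnotation.level_le {d : ℕ} {Xs : List V} {zs : List (UVar V)}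
    (h : IsAnnotation d Xs zs) : ∀ z ∈ zs, z.level ≤ d := by
  intro z hz
  cases h with
  | nil => simp at hz
  | singleton => simp_all [UVar.level]
  | unique =>
    obtain ⟨i, hi, rfl⟩ := List.mem_mapIdx.1 hz
    split_ifs <;> simp [UVar.level]
  | multiple =>
    obtain ⟨i, hi, rfl⟩ := List.mem_mapIdx.1 hz
    split_ifs <;> simp [UVar.level]

/-- Productions of `X^{=d}` in the unfolded grammar. -/
theorem eq_mem_unfoldP_iff {G : CFG V A} {k d : ℕ} {X : V} {r : List (A ⊕ UVar V)} :
    (UVar.eq X d, r) ∈ unfoldP G k ↔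
      d ≤ k ∧ ∃ rhs zs, (X, rhs) ∈ G.P ∧ IsAnnotation d (varsOf rhs) zs ∧ r = relabel rhs zs := by
  constructor
  · rintro ((((⟨_, _, _, _, _, h⟩ | ⟨X, rhs, hP, hv, h⟩) | ⟨X, rhs, Y, d, hP, hv, hd, h⟩) |
      ⟨X, rhs, d, j, hP, hl, hd, hk, hj, h⟩) | ⟨X, rhs, d, J, hP, hl, hd, hk, hJ, hJl, hdJ, h⟩)
    · simp at h
    · obtain ⟨⟨rfl, rfl⟩, rfl⟩ := by simpa using h
      exact ⟨Nat.zero_le _, rhs, [], hP, hv ▸ .nil rfl, rfl⟩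
    · obtain ⟨⟨rfl, rfl⟩, rfl⟩ := by simpa using h
      exact ⟨hd, rhs, _, hP, hv ▸ .singleton Y, rfl⟩
    · obtain ⟨⟨rfl, rfl⟩, rfl⟩ := by simpa using h
      exact ⟨hk, rhs, _, hP, .unique _ j hl hd hj, rfl⟩
    · obtain ⟨⟨rfl, rfl⟩, rfl⟩ := by simpa using h
      exact ⟨hk, rhs, _, hP, .multiple _ J hl hd hJ hJl hdJ, rfl⟩
  · rintro ⟨hk, rhs, zs, hP, hann, rfl⟩
    generalize hv : varsOf rhs = Xs at hann
    cases hann with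
    | nil hd => exact .inl <| .inl <| .inl <| .inr ⟨X, rhs, hP, hv, by rw [hd]⟩
    | singleton Y => exact .inl <| .inl <| .inr ⟨X, rhs, Y, d, hP, hv, hk, rfl⟩
    | unique _ j hl hd hj =>
      subst hv
      exact .inl <| .inr ⟨X, rhs, d, j, hP, hl, hd, hk, hj, rfl⟩
    | multiple _ J hl hd hJ hJl hdJ =>
      subst hv
      exact .inr ⟨X, rhs, d, J, hP, hl, hd, hk, hJ, hJl, hdJ, rfl⟩

/-- Productions of `X^{≤d}` in the unfolded grammar. -/
theorem le_mem_unfoldP_iff {G : CFG V A} {k d : ℕ} {X : V} {r : List (A ⊕ UVar V)} :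
    (UVar.le X d, r) ∈ unfoldP G k ↔ d ≤ k ∧ ∃ e ≤ d, r = [Sum.inr (UVar.eq X e)] := by
  simp only [unfoldP, Set.mem_union, Set.mem_ofPred_eq, Prod.mk.injEq, UVar.le.injEq,
    reduceCtorEq, false_and, and_false, exists_false, or_false]
  constructor
  · rintro ⟨_, _, e, he, hd, ⟨rfl, rfl⟩, rfl⟩
    exact ⟨hd, e, he, rfl⟩
  · rintro ⟨hd, e, he, rfl⟩
    exact ⟨X, d, e, he, hd, ⟨rfl, rfl⟩, rfl⟩

theorem IsAnnotation.eq_annotate {d : ℕ} {Xs : List V} {zs : List (UVar V)} {ds : List ℕ}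
    (h : IsAnnotation d Xs zs) (hds : List.Forall₂ UVar.Admits zs ds) :
    zs = annotate Xs ds ∧ hortonStrahler ds = d := by
  have hlen : Xs.length = ds.length := h.length_eq ▸ hds.length_eq
  cases h with
  | nil hd => cases hds; exact ⟨rfl, hd.symm⟩
  | singleton Y =>
    obtain ⟨n, hn, rfl⟩ : ∃ n, n = d ∧ ds = [n] := by
      cases hds with
      | cons hn hnil => cases hnil; exact ⟨_, hn, rfl⟩
    simp [annotate, hortonStrahler, hn]
  | unique _ j hXs hd hj =>
    have hadm := (List.forall₂_iff_get.1 hds).2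
    simp only [List.length_mapIdx, List.get_eq_getElem, List.getElem_mapIdx] at hadm
    have hjd : ds[j] = d := by simpa [UVar.Admits] using hadm j hj (hlen ▸ hj)
    have hlt : ∀ i (hi : i < ds.length), i ≠ j → ds[i] < d := fun i hi hij => by
      have : ds[i] ≤ d - 1 := by simpa [UVar.Admits, hij] using hadm i (hlen ▸ hi) hi
      omega
    obtain ⟨hmax, hhs⟩ := hortonStrahler_of_unique (ds := ds) (j := j) (m := d)
      (by rw [← hjd]; exact List.getElem?_eq_getElem _) fun i n hij hi => by
        obtain ⟨hi', rfl⟩ := List.getElem?_eq_some_iff.1 hi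
        exact hlt i hi' hij
    refine ⟨List.ext_getElem (by simp [annotate, hlen]) fun i hi _ => ?_, hhs⟩
    have hi' : i < ds.length := by simpa [hlen] using hi
    simp only [annotate, hmax, List.getElem_mapIdx, List.getElem_zipWith]
    by_cases hij : i = j
    · subst hij; simp [hjd]
    · simp [hij, (hlt i hi' hij).ne]
  | multiple _ J hXs hd hJ hJlt hdJ =>
    have hadm := (List.forall₂_iff_get.1 hds).2
    simp only [List.length_mapIdx, List.get_eq_getElem, List.getElem_mapIdx] at hadm
    have hin : ∀ i (hi : i < ds.length), i ∈ J → ds[i] = d - 1 := fun i hi hij => by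
      simpa [UVar.Admits, hij] using hadm i (hlen ▸ hi) hi
    have hout : ∀ i (hi : i < ds.length), i ∉ J → ds[i] < d - 1 := fun i hi hij => by
      have hle : ds[i] ≤ d - 2 := by simpa [UVar.Admits, hij] using hadm i (hlen ▸ hi) hi
      rcases hdJ with hd2 | rfl
      · omega
      · exact absurd (Finset.mem_range.2 (hlen ▸ hi)) hij
    have hcount : 2 ≤ ds.count (d - 1) := by
      obtain ⟨a, ha, b, hb, hab⟩ := Finset.one_lt_card.1 hJ
      have hget : ∀ i ∈ J, ds[i]? = some (d - 1) := fun i hi => by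
        rw [List.getElem?_eq_getElem (hlen ▸ hJlt i hi), hin i _ hi]
      rw [List.two_le_count_iff]
      rcases lt_or_gt_of_ne hab with hlt | hlt
      · exact ⟨a, b, hlt, hget a ha, hget b hb⟩
      · exact ⟨b, a, hlt, hget b hb, hget a ha⟩
    obtain ⟨hmax, hhs⟩ := hortonStrahler_of_two_le_count hcount fun n hn => by
      obtain ⟨i, hi, rfl⟩ := List.mem_iff_getElem.1 hn
      by_cases hij : i ∈ J
      · exact (hin i hi hij).le
      · exact (hout i hi hij).le
    refine ⟨List.ext_getElem (by simp [annotate, hlen]) fun i hi _ => ?_, by omega⟩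
    have hi' : i < ds.length := by simpa [hlen] using hi
    simp only [annotate, hmax, List.getElem_mapIdx, List.getElem_zipWith]
    by_cases hij : i ∈ J
    · simp [hij, hin i hi' hij]
    · simp [hij, (hout i hi' hij).ne, Nat.sub_sub]

theorem admits_annotate {Xs : List V} {ds : List ℕ} (hlen : Xs.length = ds.length) :
    List.Forall₂ UVar.Admits (annotate Xs ds) ds := by
  refine List.forall₂_iff_get.2 ⟨by simp [annotate, hlen], fun i _ hi => ?_⟩
  have hle : ds[i] ≤ ds.foldr max 0 := List.le_foldr_max (List.getElem_mem hi)
  simp only [annotate, List.get_eq_getElem, List.getElem_zipWith]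
  split_ifs with h
  · exact h
  · simp only [UVar.Admits]
    omega

theorem isAnnotation_annotate {Xs : List V} {ds : List ℕ} (hlen : Xs.length = ds.length) :
    IsAnnotation (hortonStrahler ds) Xs (annotate Xs ds) := by
  match Xs, ds, hlen with
  | [], [], _ => exact .nil rfl
  | [Y], [n], _ =>
    simpa [annotate, hortonStrahler] using IsAnnotation.singleton (d := n) Y
  | Y₁ :: Y₂ :: Ys, ds, hlen =>
    generalize hXs : Y₁ :: Y₂ :: Ys = Xs at hlen ⊢
    have hl : 2 ≤ Xs.length := by simp [← hXs]
    have hne : ds ≠ [] := List.ne_nil_of_length_pos (by omega)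
    set m := ds.foldr max 0 with hm
    have hmem : m ∈ ds := List.foldr_max_mem hne
    obtain ⟨j, hj, hjm⟩ := List.mem_iff_getElem.1 hmem
    have hle : ∀ i (hi : i < ds.length), ds[i] ≤ m := fun i hi =>
      List.le_foldr_max (List.getElem_mem hi)
    by_cases hc : 2 ≤ ds.count m
    · have hhs := (hortonStrahler_of_two_le_count hc fun n hn => List.le_foldr_max hn).2
      let J : Finset ℕ := {i ∈ Finset.range ds.length | ds[i]? = some m}
      have hJ : ∀ i (hi : i < ds.length), i ∈ J ↔ ds[i] = m := fun i hi => by simp [J, hi]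
      have hJcard : 2 ≤ J.card := by
        obtain ⟨a, b, hab, ha, hb⟩ := List.two_le_count_iff.1 hc
        refine Finset.one_lt_card.2 ⟨a, ?_, b, ?_, hab.ne⟩
        · simpa [J, ha] using (List.getElem?_eq_some_iff.1 ha).1
        · simpa [J, hb] using (List.getElem?_eq_some_iff.1 hb).1
      have hJlt : ∀ i ∈ J, i < Xs.length := fun i hi => by
        simp only [J, Finset.mem_filter, Finset.mem_range] at hi
        exact hlen ▸ hi.1
      have hdJ : 2 ≤ m + 1 ∨ J = Finset.range Xs.length := by
        rcases Nat.eq_zero_or_pos m with h0 | h0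
        · refine .inr (Finset.Subset.antisymm (fun i hi => Finset.mem_range.2 (hJlt i hi)) ?_)
          intro i hi
          have hi' : i < ds.length := hlen ▸ Finset.mem_range.1 hi
          have := hle i hi'
          exact (hJ i hi').2 (by omega)
        · exact .inl (by omega)
      rw [hhs]
      convert IsAnnotation.multiple (d := m + 1) Xs J hl (by omega) hJcard hJlt hdJ using 1
      refine List.ext_getElem (by simp [annotate, hlen]) fun i hi hi' => ?_
      have hi'' : i < ds.length := by simpa [hlen] using hi'
      simp only [annotate, ← hm, List.getElem_mapIdx, List.getElem_zipWith, hJ i hi'']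
      rfl
    · have huniq : ∀ i (hi : i < ds.length), i ≠ j → ds[i] < m := fun i hi hij => by
        refine lt_of_le_of_ne (hle i hi) fun him => hc (List.two_le_count_iff.2 ?_)
        have hi' : ds[i]? = some m := by simp [hi, him]
        have hj' : ds[j]? = some m := by simp [hj, hjm]
        rcases lt_or_gt_of_ne hij with hlt | hlt
        · exact ⟨i, j, hlt, hi', hj'⟩
        · exact ⟨j, i, hlt, hj', hi'⟩
      have hhs := (hortonStrahler_of_unique (ds := ds) (j := j) (m := m)
        (by simp [hj, hjm]) fun i n hij hi => by
          obtain ⟨hi', rfl⟩ := List.getElem?_eq_some_iff.1 hi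
          exact huniq i hi' hij).2
      have hpos : 1 ≤ m := by
        rcases Nat.eq_zero_or_pos j with h0 | h0
        · have := huniq 1 (by omega) (by omega)
          omega
        · have := huniq 0 (by omega) (by omega)
          omega
      rw [hhs]
      convert IsAnnotation.unique (d := m) Xs j hl hpos (hlen ▸ hj) using 1
      refine List.ext_getElem (by simp [annotate, hlen]) fun i hi hi' => ?_
      have hi'' : i < ds.length := by simpa [hlen] using hi'
      simp only [annotate, ← hm, List.getElem_mapIdx, List.getElem_zipWith]
      by_cases hij : i = j
      · subst hij; simp [hjm]
      · simp [hij, (huniq i hi'' hij).ne]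

end Annotation

/-! ### Erasing annotations is a bijection -/

section Erase

variable {V A : Type} {G : CFG V A} {k : ℕ}

theorem List.Forall₂.imp_of_mem {α β : Type*} {R S : α → β → Prop} {as : List α} {bs : List β}
    (h : List.Forall₂ R as bs) (hRS : ∀ a, ∀ b ∈ bs, R a b → S a b) :
    List.Forall₂ S as bs := by
  induction h with
  | nil => exact .nil
  | cons hab _ ih =>
    exact .cons (hRS _ _ (by simp) hab) (ih fun a b hb => hRS a b (by simp [hb]))

theorem List.Forall₂.map_eq_map_right {α β γ : Type*} {f g : β → γ} {as : List α} {bs : List β}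
    (h : List.Forall₂ (fun _ b => f b = g b) as bs) : bs.map f = bs.map g := by
  induction h with
  | nil => rfl
  | cons hab _ ih => simp [hab, ih]

theorem isDTree_le_iff {X : V} {d : ℕ} {u : RawTree (UVar V) A} :
    IsDTree (unfold G k) (UVar.le X d) u ↔ d ≤ k ∧ ∃ e ≤ d, ∃ c,
      u = .node (UVar.le X d) [Sum.inr (UVar.eq X e)] [c] ∧
        IsDTree (unfold G k) (UVar.eq X e) c := by
  constructor
  · rintro ⟨hP, hch⟩
    obtain ⟨hd, e, he, rfl⟩ := le_mem_unfoldP_iff.1 hP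
    rcases hch with _ | ⟨hc, _ | _⟩
    exact ⟨hd, e, he, _, rfl, hc⟩
  · rintro ⟨hd, e, he, c, rfl, hc⟩
    exact .node (le_mem_unfoldP_iff.2 ⟨hd, e, he, rfl⟩) (.cons hc .nil)

theorem isDTree_eq_iff {X : V} {d : ℕ} {u : RawTree (UVar V) A} :
    IsDTree (unfold G k) (UVar.eq X d) u ↔ d ≤ k ∧ ∃ rhs zs cs,
      (X, rhs) ∈ G.P ∧ IsAnnotation d (varsOf rhs) zs ∧
        u = .node (UVar.eq X d) (relabel rhs zs) cs ∧
          List.Forall₂ (IsDTree (unfold G k)) zs cs := by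
  constructor
  · rintro ⟨hP, hch⟩
    obtain ⟨hd, rhs, zs, hG, hann, rfl⟩ := eq_mem_unfoldP_iff.1 hP
    rw [varsOf_relabel rhs zs hann.length_eq] at hch
    exact ⟨hd, rhs, zs, _, hG, hann, rfl, hch⟩
  · rintro ⟨hd, rhs, zs, cs, hG, hann, rfl, hch⟩
    refine .node (eq_mem_unfoldP_iff.2 ⟨hd, rhs, zs, hG, hann, rfl⟩) ?_
    rwa [varsOf_relabel rhs zs hann.length_eq]

theorem erase_sound (u : RawTree (UVar V) A) : ∀ Z : UVar V, IsDTree (unfold G k) Z u →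
    IsDTree G Z.var (erase u) ∧ yield (erase u) = yield u ∧ Z.Admits (dim (erase u)) := by
  induction u using node_induction with
  | h Z' r cs ih =>
    rintro (⟨X, d⟩ | ⟨X, d⟩) hu
    · obtain ⟨-, e, he, c, ⟨rfl, rfl, rfl⟩, hc⟩ := by simpa using isDTree_le_iff.1 hu
      obtain ⟨hG, hy, hdim⟩ := ih c (by simp) _ hc
      rw [erase_le, yield_node]
      refine ⟨hG, by simpa [yieldAux] using hy, ?_⟩
      simp only [UVar.Admits] at hdim ⊢
      omega
    · obtain ⟨-, rhs, zs, cs', hG, hann, hnode, hcs⟩ := isDTree_eq_iff.1 hu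
      obtain ⟨rfl, rfl, rfl⟩ := by simpa using hnode
      have hch := hcs.imp_of_mem fun Z c hc => ih c hc Z
      rw [erase_eq, map_var_relabel rhs zs hann.map_var, yield_node, yield_node,
        yieldAux_relabel rhs zs _ hann.length_eq, dim_node, isDTree_node_iff, List.map_map]
      refine ⟨⟨rfl, hG, ?_⟩, ?_, ?_⟩
      · rw [← hann.map_var, List.forall₂_map_left_iff, List.forall₂_map_right_iff]
        exact hch.imp fun _ _ h => h.1
      · rw [List.Forall₂.map_eq_map_right (f := yield ∘ erase) (hch.imp fun _ _ h => h.2.1)]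
      · refine (hann.eq_annotate ?_).2
        rw [List.forall₂_map_right_iff, List.forall₂_map_right_iff]
        exact hch.imp fun _ _ h => h.2.2

theorem erase_injective (u : RawTree (UVar V) A) : ∀ (Z : UVar V) (u' : RawTree (UVar V) A),
    IsDTree (unfold G k) Z u → IsDTree (unfold G k) Z u' → erase u = erase u' → u = u' := by
  induction u using node_induction with
  | h Z' r cs ih =>
    rintro (⟨X, d⟩ | ⟨X, d⟩) u' hu hu' h
    · obtain ⟨-, e, he, c, ⟨rfl, rfl, rfl⟩, hc⟩ := by simpa using isDTree_le_iff.1 hu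
      obtain ⟨-, e', he', c', rfl, hc'⟩ := isDTree_le_iff.1 hu'
      rw [erase_le, erase_le] at h
      obtain rfl : e = e' := by
        have h₁ := (erase_sound c _ hc).2.2
        have h₂ := (erase_sound c' _ hc').2.2
        simp only [UVar.Admits, h] at h₁ h₂
        omega
      rw [ih c (by simp) _ c' hc hc' h]
    · obtain ⟨-, rhs, zs, cs₁, hG, hann, hnode, hcs⟩ := isDTree_eq_iff.1 hu
      obtain ⟨rfl, rfl, rfl⟩ := by simpa using hnode
      obtain ⟨-, rhs', zs', cs', hG', hann', rfl, hcs'⟩ := isDTree_eq_iff.1 hu'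
      rw [erase_eq, erase_eq, map_var_relabel rhs zs hann.map_var,
        map_var_relabel rhs' zs' hann'.map_var] at h
      obtain ⟨rfl, hmap⟩ := by simpa using h
      have hadm : ∀ {ys : List (UVar V)} {ts : List (RawTree (UVar V) A)},
          List.Forall₂ (IsDTree (unfold G k)) ys ts →
            List.Forall₂ UVar.Admits ys ((ts.map erase).map dim) := fun hts => by
        rw [List.forall₂_map_right_iff, List.forall₂_map_right_iff]
        exact hts.imp fun Z c hc => (erase_sound c Z hc).2.2
      obtain rfl : zs = zs' := by
        rw [(hann.eq_annotate (hadm hcs)).1, (hann'.eq_annotate (hadm hcs')).1, hmap]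
      congr 1
      clear hu hu' h hadm hann hann' hnode
      induction hcs generalizing cs' with
      | nil => cases hcs'; rfl
      | cons hc _ ih' =>
        obtain _ | ⟨hc', hcs'⟩ := hcs'
        simp only [List.map_cons, List.cons.injEq] at hmap
        rw [ih _ (by simp) _ _ hc hc' hmap.1,
          ih' (fun c hc => ih c (by simp [hc])) _ hmap.2 hcs']

theorem exists_isDTree_eq (t : RawTree V A) : ∀ X : V, IsDTree G X t → dim t ≤ k →
    ∃ u, IsDTree (unfold G k) (UVar.eq X (dim t)) u ∧ erase u = t := by
  induction t using node_induction with
  | h X' rhs cs ih =>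
    intro X ht hk
    obtain ⟨rfl, hG, hcs⟩ := isDTree_node_iff.1 ht
    rw [dim_node] at hk ⊢
    have hlen : (varsOf rhs).length = (cs.map dim).length := by simpa using hcs.length_eq
    have hann := isAnnotation_annotate hlen
    have hadm := admits_annotate hlen
    generalize annotate (varsOf rhs) (cs.map dim) = zs at hann hadm
    suffices ∃ us, List.Forall₂ (IsDTree (unfold G k)) zs us ∧ us.map erase = cs by
      obtain ⟨us, hus, hmap⟩ := this
      refine ⟨_, isDTree_eq_iff.2 ⟨hk, rhs, zs, us, hG, hann, rfl, hus⟩, ?_⟩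
      rw [erase_eq, map_var_relabel rhs zs hann.map_var, hmap]
    have hlevel : ∀ z ∈ zs, z.level ≤ k := fun z hz => (hann.level_le z hz).trans hk
    rw [← hann.map_var, List.forall₂_map_left_iff] at hcs
    rw [List.forall₂_map_right_iff] at hadm
    clear ht hann hk hlen
    induction hcs with
    | nil => exact ⟨[], .nil, rfl⟩
    | @cons z c zs cs hc _ ih' =>
      obtain _ | ⟨hz, hadm⟩ := hadm
      obtain ⟨us, hus, hmap⟩ := ih' (fun c hc => ih c (by simp [hc])) hadm
        fun z hz => hlevel z (by simp [hz])
      have hzk : z.level ≤ k := hlevel z (by simp)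
      suffices ∃ u, IsDTree (unfold G k) z u ∧ erase u = c by
        obtain ⟨u, hu, hc⟩ := this
        exact ⟨u :: us, .cons hu hus, by simp [hc, hmap]⟩
      rcases z with ⟨Y, d⟩ | ⟨Y, d⟩ <;> simp only [UVar.Admits, UVar.level] at hz hzk
      · obtain ⟨u, hu, hc⟩ := ih c (by simp) Y hc (hz.trans hzk)
        exact ⟨_, isDTree_le_iff.2 ⟨hzk, _, hz, u, rfl, hu⟩, by rw [erase_le, hc]⟩
      · subst hz
        exact ih c (by simp) Y hc hzk

end Erase

/-- The ambiguity of the unfolded grammar `G^{≤k}` at `X^{≤k}` counts exactly the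
`(G,X)`-derivation trees of dimension at most `k` with the given yield. -/
theorem unfold_amb {V A : Type} [Fintype V] [Fintype A]
    (G : CFG V A) (hGfin : G.P.Finite) (k : ℕ) (X : V) (w : List A) :
    amb (unfold G k) (UVar.le X k) w
      = Set.encard {t : RawTree V A | IsDTree G X t ∧ yield t = w ∧ dim t ≤ k} := by
  have hinj : Set.InjOn erase
      {u : RawTree (UVar V) A | IsDTree (unfold G k) (UVar.le X k) u ∧ yield u = w} :=
    fun u hu u' hu' h => erase_injective u _ u' hu.1 hu'.1 h
  rw [amb, ← hinj.encard_image]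
  congr 1
  ext t
  constructor
  · rintro ⟨u, ⟨hu, rfl⟩, rfl⟩
    exact erase_sound u _ hu
  · rintro ⟨ht, rfl, hk⟩
    obtain ⟨u, hu, rfl⟩ := exists_isDTree_eq t X ht hk
    have hle := isDTree_le_iff.2 ⟨le_rfl, _, hk, u, rfl, hu⟩
    refine ⟨_, ⟨hle, ?_⟩, erase_le ..⟩
    rw [← (erase_sound _ _ hle).2.1, erase_le]
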